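/- arXiv:1708.07385 — 8 statements merged into one kernel-verified Lean document; each statement's English description precedes it below -/
import Mathlib

section
/- Let M > 0 and a be real with |a| < M, let m be an integer, and let r be real with r ≥ M + √(M² + a²). Set Δ := r² − 2Mr + a². Then max{6, m² + |m|} − a²m²/Δ + (8a² − 8Mr)/r² ≥ 0. (This is the nonnegativity, for spin weight |s| = 2, of the coefficient A¹_{m,s} = max{s²+|s|, m²+|m|} − a²m²/Δ + s²(Δ + a² − r²)/r² appearing in the energy density for the operator 𝐋¹_s, using s² = 4 and Δ + a² − r² = 2a² − 2Mr.) -/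
/-- Nonnegativity of the coefficient `A¹_{m,±2}` for `r ≥ M + √(M²+a²)`. -/
theorem A1_coefficient_nonneg (M a : ℝ) (hM : 0 < M) (ha : |a| < M) (m : ℤ)
    (r : ℝ) (hr : M + Real.sqrt (M ^ 2 + a ^ 2) ≤ r) :
    0 ≤ max 6 ((m : ℝ) ^ 2 + |(m : ℝ)|)
        - a ^ 2 * (m : ℝ) ^ 2 / (r ^ 2 - 2 * M * r + a ^ 2)
        + (8 * a ^ 2 - 8 * M * r) / r ^ 2 := by
  have hs := Real.sqrt_nonneg (M ^ 2 + a ^ 2)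
  have hsq := Real.sq_sqrt (show 0 ≤ M ^ 2 + a ^ 2 by positivity)
  have hr0 : 0 < r := by linarith
  have key : a ^ 2 ≤ r ^ 2 - 2 * M * r := by nlinarith
  have hΔ : a ^ 2 * (m : ℝ) ^ 2 / (r ^ 2 - 2 * M * r + a ^ 2) ≤ (m : ℝ) ^ 2 / 2 := by
    apply div_le_of_le_mul₀ (by nlinarith [sq_nonneg a]) (by positivity)
    nlinarith [mul_le_mul_of_nonneg_right key (sq_nonneg (m : ℝ))]
  have hpot : -4 ≤ (8 * a ^ 2 - 8 * M * r) / r ^ 2 := by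
    rw [le_div_iff₀ (by positivity)]
    nlinarith [sq_nonneg a]
  have hmax : (m : ℝ) ^ 2 / 2 + 4 ≤ max 6 ((m : ℝ) ^ 2 + |(m : ℝ)|) := by
    have habs := abs_nonneg (m : ℝ)
    rw [← sq_abs (m : ℝ)]
    rcases le_total |(m : ℝ)| 2 with h | h
    · exact le_max_of_le_left (by nlinarith)
    · exact le_max_of_le_right (by nlinarith)
  linarith
end

section
/- Let M > 0 and a be real with |a| < M, let m be an integer, and let r be real with r ≥ M + √(M² + a²). Set Δ := r² − 2Mr + a². Then max{6, m² + |m|} − a²m²/Δ − 2(Δ + a²)/r² ≥ 0. (This is the nonnegativity, for spin weight |s| = 2, of the coefficient A⁰_{m,s} = max{|s|(|s|+1), |m|(|m|+1)} − a²m²/Δ − s²(Δ + a²)/(2r²) appearing in the energy density for the operator 𝐋⁰_s.) -/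
/-- Nonnegativity of the coefficient `A⁰_{m,±2}` for `r ≥ M + √(M²+a²)`. -/
theorem A0_coefficient_nonneg (M a : ℝ) (hM : 0 < M) (ha : |a| < M) (m : ℤ)
    (r : ℝ) (hr : M + Real.sqrt (M ^ 2 + a ^ 2) ≤ r) :
    0 ≤ max 6 ((m : ℝ) ^ 2 + |(m : ℝ)|)
        - a ^ 2 * (m : ℝ) ^ 2 / (r ^ 2 - 2 * M * r + a ^ 2)
        - 2 * ((r ^ 2 - 2 * M * r + a ^ 2) + a ^ 2) / r ^ 2 := by
  have hs : 0 ≤ Real.sqrt (M ^ 2 + a ^ 2) := Real.sqrt_nonneg _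
  have hsq : Real.sqrt (M ^ 2 + a ^ 2) ^ 2 = M ^ 2 + a ^ 2 := Real.sq_sqrt (by positivity)
  have hΔ : 2 * a ^ 2 ≤ r ^ 2 - 2 * M * r + a ^ 2 := by nlinarith
  have hr0 : 0 < r := by linarith
  have haM : a ^ 2 ≤ M ^ 2 := (sq_lt_sq' (abs_lt.mp ha).1 (abs_lt.mp ha).2).le
  have h₁ : a ^ 2 * (m : ℝ) ^ 2 / (r ^ 2 - 2 * M * r + a ^ 2) ≤ (m : ℝ) ^ 2 / 2 :=
    div_le_of_le_mul₀ (by nlinarith [sq_nonneg a]) (by positivity)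
      (by nlinarith [mul_le_mul_of_nonneg_left hΔ (sq_nonneg (m : ℝ))])
  have h₂ : 2 * ((r ^ 2 - 2 * M * r + a ^ 2) + a ^ 2) / r ^ 2 ≤ 2 := by
    rw [div_le_iff₀ (by positivity)]
    nlinarith [mul_le_mul_of_nonneg_left (show M ≤ r by linarith) hM.le]
  have h₃ := le_max_left 6 ((m : ℝ) ^ 2 + |(m : ℝ)|)
  have h₄ := le_max_right 6 ((m : ℝ) ^ 2 + |(m : ℝ)|)
  linarith [abs_nonneg (m : ℝ)]
end

section
/- Let M > 0 and a be real with 0 < |a| < M, let m be an integer with |m| ≤ 1 or |m| ≥ 4, and let r be real with r ≥ 2M. Set Δ := r² − 2Mr + a². Then both max{6, m² + |m|} − a²m²/Δ + (8a² − 8Mr)/r² ≥ 0 and max{6, m² + |m|} − a²m²/Δ − 2(Δ + a²)/r² ≥ 0; that is, for azimuthal numbers m with |m| ∉ {2,3}, the energy-density coefficients A¹_{m,±2} and A⁰_{m,±2} are nonnegative already for all r ≥ 2M. -/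
/-- For azimuthal numbers `m` with `|m| ∉ {2,3}`, the energy-density coefficients
`A¹_{m,±2}` and `A⁰_{m,±2}` are nonnegative already for all `r ≥ 2M`. -/
theorem A_coefficients_nonneg_of_small_or_large_m (M a : ℝ) (hM : 0 < M)
    (ha0 : 0 < |a|) (ha : |a| < M) (m : ℤ) (hm : |m| ≤ 1 ∨ 4 ≤ |m|)
    (r : ℝ) (hr : 2 * M ≤ r) :
    0 ≤ max 6 ((m : ℝ) ^ 2 + |(m : ℝ)|)
        - a ^ 2 * (m : ℝ) ^ 2 / (r ^ 2 - 2 * M * r + a ^ 2)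
        + (8 * a ^ 2 - 8 * M * r) / r ^ 2 ∧
    0 ≤ max 6 ((m : ℝ) ^ 2 + |(m : ℝ)|)
        - a ^ 2 * (m : ℝ) ^ 2 / (r ^ 2 - 2 * M * r + a ^ 2)
        - 2 * ((r ^ 2 - 2 * M * r + a ^ 2) + a ^ 2) / r ^ 2 := by
  have hr0 : 0 < r := by linarith
  have hr2 : 0 < r ^ 2 := by positivity
  have ha2 : 0 < a ^ 2 := by
    have : a ≠ 0 := abs_pos.mp ha0
    positivity
  have haM : a ^ 2 < M ^ 2 := by
    rw [← sq_abs a]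
    gcongr
  have hMr : 2 * M * r ≤ r ^ 2 := by nlinarith
  have hΔ : 0 < r ^ 2 - 2 * M * r + a ^ 2 := by linarith
  have hquot : a ^ 2 * (m : ℝ) ^ 2 / (r ^ 2 - 2 * M * r + a ^ 2) ≤ (m : ℝ) ^ 2 := by
    rw [div_le_iff₀ hΔ]
    nlinarith [mul_nonneg (sq_nonneg (m : ℝ)) (sub_nonneg.mpr hMr)]
  have hmain : 4 ≤ max 6 ((m : ℝ) ^ 2 + |(m : ℝ)|)
      - a ^ 2 * (m : ℝ) ^ 2 / (r ^ 2 - 2 * M * r + a ^ 2) := by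
    rcases hm with hm | hm
    · have h1 : |(m : ℝ)| ≤ 1 := by exact_mod_cast hm
      have h2 : (m : ℝ) ^ 2 ≤ 1 := (sq_le_one_iff_abs_le_one _).mpr h1
      linarith [le_max_left 6 ((m : ℝ) ^ 2 + |(m : ℝ)|)]
    · have h1 : 4 ≤ |(m : ℝ)| := by exact_mod_cast hm
      linarith [le_max_right 6 ((m : ℝ) ^ 2 + |(m : ℝ)|)]
  constructor
  · have h : -4 ≤ (8 * a ^ 2 - 8 * M * r) / r ^ 2 := by
      rw [le_div_iff₀ hr2]
      linarith
    linarith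
  · have h : 2 * ((r ^ 2 - 2 * M * r + a ^ 2) + a ^ 2) / r ^ 2 ≤ 4 := by
      rw [div_le_iff₀ hr2]
      nlinarith
    linarith
end

section
/- Let M > 0. There exists a constant ε > 0 such that for every smooth function φ : ℝ → ℂ compactly supported in (2M, ∞), ∫_{2M}^{∞} [ M(r−2M)²/r² · |φ′(r)|² + ( (3/2)M/r² − 9M²/r³ + 13M³/r⁴ ) |φ(r)|² ] dr ≥ ε ∫_{2M}^{∞} [ (r−2M)²/r² · |φ′(r)|² + |φ(r)|²/r² ] dr. -/
open MeasureTheory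

/-- A function supported in the compact set `tsupport φ` and continuous there is integrable. -/
lemma integrable_of_continuousOn_tsupport {φ : ℝ → ℂ} (hc : HasCompactSupport φ) {g : ℝ → ℝ}
    (hg : ContinuousOn g (tsupport φ)) (hs : ∀ x ∉ tsupport φ, g x = 0) : Integrable g := by
  have hsupp : Function.support g ⊆ tsupport φ := fun x hx => by
    by_contra h
    exact hx (hs x h)
  exact (integrableOn_iff_integrable_of_support_subset hsupp).1
    (hg.integrableOn_compact hc.isCompact)

/-- The derivative of the weight `(3/4) M (r - 2M)² / r³`. -/
lemma hasDerivAt_hardyWeight (M : ℝ) {r : ℝ} (hr : r ≠ 0) :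
    HasDerivAt (fun r : ℝ => 3 / 4 * M * (r - 2 * M) ^ 2 / r ^ 3)
      (3 / 4 * M * (-1 / r ^ 2 + 8 * M / r ^ 3 - 12 * M ^ 2 / r ^ 4)) r := by
  have h := ((((hasDerivAt_id r).sub_const (2 * M)).pow 2).const_mul (3 / 4 * M)).div
    ((hasDerivAt_id r).pow 3) (pow_ne_zero 3 hr)
  refine h.congr_deriv ?_
  simp only [id, Pi.pow_apply]
  field_simp
  ring

/-- Pointwise lower bound, by completing the square in `b - 4a/(5r)`. Here `a`, `b`, `i` stand
for `‖φ‖`, `‖φ'‖` and the real inner product of `φ` and `φ'`. -/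
lemma hardy_pointwise {M r a b i : ℝ} (hM : 0 < M) (hr : 0 < r) (hi : |i| ≤ a * b) :
    M / 16 * ((r - 2 * M) ^ 2 / r ^ 2 * b ^ 2 + a ^ 2 / r ^ 2)
      ≤ (M * (r - 2 * M) ^ 2 / r ^ 2 * b ^ 2
          + ((3 / 2) * M / r ^ 2 - 9 * M ^ 2 / r ^ 3 + 13 * M ^ 3 / r ^ 4) * a ^ 2)
        + (3 / 4 * M * (-1 / r ^ 2 + 8 * M / r ^ 3 - 12 * M ^ 2 / r ^ 4) * a ^ 2
          + 3 / 4 * M * (r - 2 * M) ^ 2 / r ^ 3 * (2 * i)) := by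
  have h_cross : 0 ≤ 3 / 2 * M * (r - 2 * M) ^ 2 / r ^ 3 * (i + a * b) :=
    mul_nonneg (by positivity) (by linarith [(abs_le.1 hi).1])
  have h_square : 0 ≤ 15 / 16 * M * (r - 2 * M) ^ 2 / r ^ 2 * (b - 4 / 5 * a / r) ^ 2 := by
    positivity
  have h_quad : 0 ≤ 7 / 80 * r ^ 2 - 3 / 5 * r * M + 8 / 5 * M ^ 2 := by
    nlinarith [sq_nonneg (r - 24 / 7 * M), sq_nonneg M]
  have h_rest : 0 ≤ M * a ^ 2 / r ^ 4 * (7 / 80 * r ^ 2 - 3 / 5 * r * M + 8 / 5 * M ^ 2) :=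
    mul_nonneg (by positivity) h_quad
  have key : (M * (r - 2 * M) ^ 2 / r ^ 2 * b ^ 2
          + ((3 / 2) * M / r ^ 2 - 9 * M ^ 2 / r ^ 3 + 13 * M ^ 3 / r ^ 4) * a ^ 2)
        + (3 / 4 * M * (-1 / r ^ 2 + 8 * M / r ^ 3 - 12 * M ^ 2 / r ^ 4) * a ^ 2
          + 3 / 4 * M * (r - 2 * M) ^ 2 / r ^ 3 * (2 * i))
      - M / 16 * ((r - 2 * M) ^ 2 / r ^ 2 * b ^ 2 + a ^ 2 / r ^ 2)
      = 3 / 2 * M * (r - 2 * M) ^ 2 / r ^ 3 * (i + a * b)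
        + 15 / 16 * M * (r - 2 * M) ^ 2 / r ^ 2 * (b - 4 / 5 * a / r) ^ 2
        + M * a ^ 2 / r ^ 4 * (7 / 80 * r ^ 2 - 3 / 5 * r * M + 8 / 5 * M ^ 2) := by
    field_simp
    ring
  linarith

/-- Hardy inequality for the Morawetz bulk term with residual potential `V̄¹`
on Schwarzschild. -/
theorem hardy_inequality_V1 (M : ℝ) (hM : 0 < M) :
    ∃ ε > (0 : ℝ), ∀ φ : ℝ → ℂ, ContDiff ℝ (⊤ : ℕ∞) φ → HasCompactSupport φ →
      tsupport φ ⊆ Set.Ioi (2 * M) →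
      ε * ∫ r in Set.Ioi (2 * M),
            ((r - 2 * M) ^ 2 / r ^ 2 * ‖deriv φ r‖ ^ 2 + ‖φ r‖ ^ 2 / r ^ 2)
      ≤ ∫ r in Set.Ioi (2 * M),
            (M * (r - 2 * M) ^ 2 / r ^ 2 * ‖deriv φ r‖ ^ 2
              + ((3 / 2) * M / r ^ 2 - 9 * M ^ 2 / r ^ 3 + 13 * M ^ 3 / r ^ 4)
                * ‖φ r‖ ^ 2) := by
  refine ⟨M / 16, by positivity, fun φ hφ hc hsub => ?_⟩
  have hφc : Continuous φ := hφ.continuous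
  have hdc : Continuous (deriv φ) := hφ.continuous_deriv (by simp)
  have hne : ∀ r ∈ tsupport φ, r ≠ 0 := fun r hr => by
    have : 2 * M < r := hsub hr
    linarith
  have hφ0 : ∀ r ∉ tsupport φ, φ r = 0 := fun r hr => image_eq_zero_of_notMem_tsupport hr
  have hd0 : ∀ r ∉ tsupport φ, deriv φ r = 0 := fun r hr => by
    by_contra h
    exact hr (support_deriv_subset h)
  have h_int_left : Integrable fun r : ℝ =>
      (r - 2 * M) ^ 2 / r ^ 2 * ‖deriv φ r‖ ^ 2 + ‖φ r‖ ^ 2 / r ^ 2 := by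
    refine integrable_of_continuousOn_tsupport hc ?_ fun r hr => by simp [hφ0 r hr, hd0 r hr]
    refine fun r hr => ContinuousAt.continuousWithinAt ?_
    have := hne r hr
    fun_prop (disch := positivity)
  have h_int_right : Integrable fun r : ℝ =>
      M * (r - 2 * M) ^ 2 / r ^ 2 * ‖deriv φ r‖ ^ 2
        + ((3 / 2) * M / r ^ 2 - 9 * M ^ 2 / r ^ 3 + 13 * M ^ 3 / r ^ 4) * ‖φ r‖ ^ 2 := by
    refine integrable_of_continuousOn_tsupport hc ?_ fun r hr => by simp [hφ0 r hr, hd0 r hr]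
    refine fun r hr => ContinuousAt.continuousWithinAt ?_
    have := hne r hr
    fun_prop (disch := positivity)
  have h_int_flux : Integrable fun r : ℝ =>
      3 / 4 * M * (-1 / r ^ 2 + 8 * M / r ^ 3 - 12 * M ^ 2 / r ^ 4) * ‖φ r‖ ^ 2
        + 3 / 4 * M * (r - 2 * M) ^ 2 / r ^ 3 * (2 * inner ℝ (φ r) (deriv φ r)) := by
    refine integrable_of_continuousOn_tsupport hc ?_ fun r hr => by simp [hφ0 r hr]
    refine fun r hr => ContinuousAt.continuousWithinAt ?_
    have := hne r hr
    fun_prop (disch := positivity)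
  have h_deriv : ∀ r : ℝ, r ≠ 0 → HasDerivAt
      (fun r : ℝ => 3 / 4 * M * (r - 2 * M) ^ 2 / r ^ 3 * ‖φ r‖ ^ 2)
      (3 / 4 * M * (-1 / r ^ 2 + 8 * M / r ^ 3 - 12 * M ^ 2 / r ^ 4) * ‖φ r‖ ^ 2
        + 3 / 4 * M * (r - 2 * M) ^ 2 / r ^ 3 * (2 * inner ℝ (φ r) (deriv φ r))) r :=
    fun r hr => (hasDerivAt_hardyWeight M hr).mul
      ((hφ.differentiable (by simp)) r).hasDerivAt.norm_sq
  have h_lim : Filter.Tendsto (fun r : ℝ => 3 / 4 * M * (r - 2 * M) ^ 2 / r ^ 3 * ‖φ r‖ ^ 2)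
      Filter.atTop (nhds 0) := by
    refine tendsto_const_nhds.congr' ?_
    filter_upwards [atTop_le_cocompact hc.isCompact.compl_mem_cocompact] with r hr
    simp [hφ0 r hr]
  have h_flux : ∫ r in Set.Ioi (2 * M),
      (3 / 4 * M * (-1 / r ^ 2 + 8 * M / r ^ 3 - 12 * M ^ 2 / r ^ 4) * ‖φ r‖ ^ 2
        + 3 / 4 * M * (r - 2 * M) ^ 2 / r ^ 3 * (2 * inner ℝ (φ r) (deriv φ r))) = 0 := by
    rw [integral_Ioi_of_hasDerivAt_of_tendsto
      (h_deriv (2 * M) (by positivity)).continuousAt.continuousWithinAt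
      (fun r hr => h_deriv r (by have : 2 * M < r := hr; linarith))
      h_int_flux.integrableOn h_lim]
    simp
  rw [← integral_const_mul]
  calc _ ≤ _ := setIntegral_mono_on (h_int_left.const_mul _).integrableOn
        (h_int_right.add h_int_flux).integrableOn measurableSet_Ioi fun r hr =>
          hardy_pointwise hM (by have : 2 * M < r := hr; linarith)
            (abs_real_inner_le_norm (φ r) (deriv φ r))
    _ = _ := by
      rw [integral_add' h_int_right.integrableOn h_int_flux.integrableOn, h_flux, add_zero]
end

section
/- Let M > 0. There exists a constant ε > 0 such that for every smooth function φ : ℝ → ℂ compactly supported in (2M, ∞), ∫_{2M}^{∞} [ M(r−2M)²/r² · |φ′(r)|² + ( (31/6)M/r² − 30M²/r³ + 43M³/r⁴ ) |φ(r)|² ] dr ≥ ε ∫_{2M}^{∞} [ (r−2M)²/r² · |φ′(r)|² + |φ(r)|²/r² ] dr. -/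
open MeasureTheory

/-- A function continuous on an open half-line and supported in the compact topological support
of `φ` is integrable there. -/
lemma integrableOn_Ioi_of_continuousOn_of_support_subset_tsupport {φ : ℝ → ℂ} {a : ℝ} {f : ℝ → ℝ}
    (hc : HasCompactSupport φ) (hs : tsupport φ ⊆ Set.Ioi a)
    (hf : ContinuousOn f (Set.Ioi a)) (hsupp : Function.support f ⊆ tsupport φ) :
    IntegrableOn f (Set.Ioi a) :=
  ((integrableOn_iff_integrable_of_support_subset hsupp).1
    ((hf.mono hs).integrableOn_compact hc)).integrableOn

/-- Completing the square with weight `1 / r`: the difference of the two Hardy integrands is bounded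
below by minus the derivative of `M (r - 2M)² / r³ * n²`, where `n = ‖φ‖`, `d = ‖φ'‖` and
`t = ⟪φ, φ'⟫`. -/
lemma hardy_integrand_bound {M r n d t : ℝ} (hM : 0 < M) (hr : 2 * M < r)
    (hQ : ∀ c : ℝ, 0 ≤ d ^ 2 + 2 * c * t + c ^ 2 * n ^ 2) :
    M / 18 * ((r - 2 * M) ^ 2 / r ^ 2 * d ^ 2 + n ^ 2 / r ^ 2)
      - ((M * (2 * (r - 2 * M)) * r ^ 3 - M * (r - 2 * M) ^ 2 * (3 * r ^ 2)) / (r ^ 3) ^ 2 * n ^ 2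
          + M * (r - 2 * M) ^ 2 / r ^ 3 * (2 * t))
      ≤ M * (r - 2 * M) ^ 2 / r ^ 2 * d ^ 2
          + ((31 / 6) * M / r ^ 2 - 30 * M ^ 2 / r ^ 3 + 43 * M ^ 3 / r ^ 4) * n ^ 2 := by
  have hr0 : 0 < r := by linarith
  have h1 : 0 ≤ M * (r - 2 * M) ^ 2 / r ^ 2 * (8 / 9)
      * (d ^ 2 + 2 * (1 / r) * t + (1 / r) ^ 2 * n ^ 2) := mul_nonneg (by positivity) (hQ _)
  have h2 : 0 ≤ M * (r - 2 * M) ^ 2 / r ^ 2 * (1 / 18)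
      * (d ^ 2 + 2 * (2 / r) * t + (2 / r) ^ 2 * n ^ 2) := mul_nonneg (by positivity) (hQ _)
  have h3 : 0 ≤ n ^ 2 * M / r ^ 4 * (3 * (3 * M - r) ^ 2 + 4 / 9 * (M * (r - M))) := by
    have : 0 ≤ r - M := by linarith
    positivity
  rw [← sub_nonneg]
  refine (add_nonneg (add_nonneg h1 h2) h3).trans_eq ?_
  field_simp
  ring

/-- Hardy inequality for the Morawetz bulk term with residual potential `V̄⁰`
on Schwarzschild. -/
theorem hardy_inequality_V0 (M : ℝ) (hM : 0 < M) :
    ∃ ε > (0 : ℝ), ∀ φ : ℝ → ℂ, ContDiff ℝ (⊤ : ℕ∞) φ → HasCompactSupport φ →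
      tsupport φ ⊆ Set.Ioi (2 * M) →
      ε * ∫ r in Set.Ioi (2 * M),
            ((r - 2 * M) ^ 2 / r ^ 2 * ‖deriv φ r‖ ^ 2 + ‖φ r‖ ^ 2 / r ^ 2)
      ≤ ∫ r in Set.Ioi (2 * M),
            (M * (r - 2 * M) ^ 2 / r ^ 2 * ‖deriv φ r‖ ^ 2
              + ((31 / 6) * M / r ^ 2 - 30 * M ^ 2 / r ^ 3 + 43 * M ^ 3 / r ^ 4)
                * ‖φ r‖ ^ 2) := by
  refine ⟨M / 18, by positivity, fun φ hφ hc hs => ?_⟩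
  have hφ' : Continuous (deriv φ) := hφ.continuous_deriv (by simp)
  have hφc : Continuous φ := hφ.continuous
  have hpos : ∀ r ∈ Set.Ioi (2 * M), r ≠ 0 := fun r hr => by
    have : 2 * M < r := hr
    exact (by linarith : 0 < r).ne'
  have hzero : ∀ r ∉ tsupport φ, φ r = 0 ∧ deriv φ r = 0 := fun r hr =>
    ⟨image_eq_zero_of_notMem_tsupport hr,
      Function.notMem_support.1 fun h => hr (support_deriv_subset h)⟩
  have integrable_of : ∀ f : ℝ → ℝ, ContinuousOn f (Set.Ioi (2 * M)) →
      (∀ r, φ r = 0 → deriv φ r = 0 → f r = 0) → IntegrableOn f (Set.Ioi (2 * M)) := by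
    intro f hf h
    refine integrableOn_Ioi_of_continuousOn_of_support_subset_tsupport hc hs hf fun r hr => ?_
    by_contra hn
    exact hr (h r (hzero r hn).1 (hzero r hn).2)
  let g : ℝ → ℝ := fun r => M * (r - 2 * M) ^ 2 / r ^ 3 * ‖φ r‖ ^ 2
  let g' : ℝ → ℝ := fun r =>
    (M * (2 * (r - 2 * M)) * r ^ 3 - M * (r - 2 * M) ^ 2 * (3 * r ^ 2)) / (r ^ 3) ^ 2 * ‖φ r‖ ^ 2
      + M * (r - 2 * M) ^ 2 / r ^ 3 * (2 * inner ℝ (φ r) (deriv φ r))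
  have hg : ∀ r ∈ Set.Ioi (2 * M), HasDerivAt g (g' r) r := by
    intro r hr
    have hd : HasDerivAt φ (deriv φ r) r := (hφ.differentiable (by simp) r).hasDerivAt
    have hn : HasDerivAt (fun r : ℝ => M * (r - 2 * M) ^ 2) (M * (2 * (r - 2 * M))) r := by
      simpa using (((hasDerivAt_id r).sub_const (2 * M)).pow 2).const_mul M
    have hp : HasDerivAt (fun r : ℝ => r ^ 3) (3 * r ^ 2) r := by
      simpa using hasDerivAt_pow 3 r
    exact (hn.div hp (pow_ne_zero 3 (hpos r hr))).mul hd.norm_sq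
  have hg'_int : IntegrableOn g' (Set.Ioi (2 * M)) := by
    refine integrable_of _ ?_ fun r h0 h1 => by simp [g', h0]
    fun_prop (disch := first | assumption | (intro r hr; have := hpos r hr; positivity))
  have hgz : ∀ r ∉ tsupport φ, g r = 0 := fun r hr => by simp [g, (hzero r hr).1]
  have hg'_zero : ∫ r in Set.Ioi (2 * M), g' r = 0 := by
    have hleft : ContinuousWithinAt g (Set.Ici (2 * M)) (2 * M) := by
      have : ContinuousAt g (2 * M) := by
        have h : (2 * M : ℝ) ≠ 0 := by positivity
        have : (2 * M) ^ 3 ≠ 0 := pow_ne_zero 3 h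
        fun_prop (disch := assumption)
      exact this.continuousWithinAt
    have htop : Filter.Tendsto g Filter.atTop (nhds 0) := by
      obtain ⟨b, hb⟩ := hc.isCompact.bddAbove
      refine tendsto_const_nhds.congr' ?_
      filter_upwards [Filter.eventually_gt_atTop b] with r hr
      exact (hgz r fun h => hr.not_ge (hb h)).symm
    rw [integral_Ioi_of_hasDerivAt_of_tendsto hleft hg hg'_int htop]
    simp [g]
  have hG : IntegrableOn (fun r => (r - 2 * M) ^ 2 / r ^ 2 * ‖deriv φ r‖ ^ 2 + ‖φ r‖ ^ 2 / r ^ 2)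
      (Set.Ioi (2 * M)) := by
    refine integrable_of _ ?_ fun r h0 h1 => by simp [h0, h1]
    fun_prop (disch := first | assumption | (intro r hr; have := hpos r hr; positivity))
  have hF : IntegrableOn (fun r => M * (r - 2 * M) ^ 2 / r ^ 2 * ‖deriv φ r‖ ^ 2
      + ((31 / 6) * M / r ^ 2 - 30 * M ^ 2 / r ^ 3 + 43 * M ^ 3 / r ^ 4) * ‖φ r‖ ^ 2)
      (Set.Ioi (2 * M)) := by
    refine integrable_of _ ?_ fun r h0 h1 => by simp [h0, h1]
    fun_prop (disch := first | assumption | (intro r hr; have := hpos r hr; positivity))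
  have key := setIntegral_mono_on ((hG.const_mul (M / 18)).sub hg'_int) hF measurableSet_Ioi
    fun r hr => hardy_integrand_bound (n := ‖φ r‖) (d := ‖deriv φ r‖)
      (t := inner ℝ (φ r) (deriv φ r)) hM hr fun c => by
        have h := norm_add_sq_real (deriv φ r) (c • φ r)
        rw [inner_smul_right, real_inner_comm, norm_smul, mul_pow, Real.norm_eq_abs, sq_abs] at h
        linarith [sq_nonneg ‖deriv φ r + c • φ r‖]
  simp only [Pi.sub_apply] at key
  rwa [integral_sub (hG.const_mul (M / 18)) hg'_int, hg'_zero, sub_zero, integral_const_mul] at key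
end

section
/- Let M > 0. There exists a function u : ℝ → ℝ that is twice continuously differentiable on (2M, ∞), satisfies u(r) > 0 for every r > 2M, and solves the ordinary differential equation d/dr [ M(r−2M)²/r² · u′(r) ] = ( (3/2)M/r² − 9M²/r³ + 13M³/r⁴ ) u(r) for all r ∈ (2M, ∞). -/
open Set Filter Topology in
/-- The weighted coefficients `n * a n` of the Euler derivative `x * f'` of `∑ a n * x ^ n`
still give a convergent series at smaller arguments. -/
theorem summable_natCast_mul_mul_pow {a : ℕ → ℝ}
    (ha : ∀ x ∈ Ioo (0 : ℝ) 1, Summable fun n => a n * x ^ n) :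
    ∀ x ∈ Ioo (0 : ℝ) 1, Summable fun n : ℕ => n * a n * x ^ n := by
  intro x hx
  obtain ⟨y, hxy, hy⟩ := exists_between hx.2
  have hy0 : 0 < y := hx.1.trans hxy
  have hlim := (ha y ⟨hy0, hy⟩).tendsto_atTop_zero
  obtain ⟨C, hC⟩ := hlim.norm.bddAbove_range
  have hgeom : Summable fun n : ℕ => (n : ℝ) ^ 1 * (x / y) ^ n := by
    apply summable_pow_mul_geometric_of_norm_lt_one
    rw [Real.norm_of_nonneg (by have := hx.1; positivity)]
    exact (div_lt_one hy0).2 hxy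
  refine Summable.of_norm_bounded (hgeom.mul_left C) fun n => ?_
  have hCn : ‖a n * y ^ n‖ ≤ C := hC ⟨n, rfl⟩
  have hpos : 0 ≤ (n : ℝ) ^ 1 * (x / y) ^ n := by have := hx.1; positivity
  calc ‖n * a n * x ^ n‖ = ‖(a n * y ^ n) * ((n : ℝ) ^ 1 * (x / y) ^ n)‖ := by
        rw [div_pow]
        congr 1
        field_simp
    _ = ‖a n * y ^ n‖ * ((n : ℝ) ^ 1 * (x / y) ^ n) := by
        rw [norm_mul, Real.norm_of_nonneg hpos]
    _ ≤ _ := mul_le_mul_of_nonneg_right hCn hpos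

open Set in
/-- Termwise differentiation of a power series on `(0, 1)`, in terms of the Euler operator. -/
theorem hasDerivAt_tsum_mul_pow {a : ℕ → ℝ}
    (ha : ∀ x ∈ Ioo (0 : ℝ) 1, Summable fun n => a n * x ^ n) {x : ℝ} (hx : x ∈ Ioo (0 : ℝ) 1) :
    HasDerivAt (fun y => ∑' n, a n * y ^ n) ((∑' n : ℕ, n * a n * x ^ n) / x) x := by
  obtain ⟨z, hxz, hz⟩ := exists_between hx.2
  have hz0 : 0 < z := hx.1.trans hxz
  have hsum : Summable fun n : ℕ => ‖n * a n * z ^ n‖ / z :=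
    ((summable_natCast_mul_mul_pow ha z ⟨hz0, hz⟩).norm).div_const z
  have key := hasDerivAt_tsum_of_isPreconnected (g := fun n y => a n * y ^ n)
    (g' := fun n y => a n * (n * y ^ (n - 1))) (t := Ioo 0 z) (y₀ := x) (y := x) hsum isOpen_Ioo
    isPreconnected_Ioo (fun n y _ => (hasDerivAt_pow n y).const_mul (a n)) (fun n y hy => by
      rcases n with _ | n
      · simp
      · have hyz : y ^ n ≤ z ^ n := pow_le_pow_left₀ hy.1.le hy.2.le n
        have hrw : ‖((n + 1 : ℕ) : ℝ) * a (n + 1) * z ^ (n + 1)‖ / z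
            = ‖a (n + 1)‖ * ((n + 1 : ℕ) * z ^ n) := by
          rw [norm_mul, norm_mul, Real.norm_of_nonneg (pow_nonneg hz0.le _),
            Real.norm_of_nonneg (Nat.cast_nonneg _)]
          field_simp
          ring
        rw [hrw, norm_mul, Nat.add_sub_cancel,
          Real.norm_of_nonneg (mul_nonneg (Nat.cast_nonneg _) (pow_nonneg hy.1.le _))]
        gcongr) ⟨hx.1, hxz⟩ (ha x hx) ⟨hx.1, hxz⟩
  refine key.congr_deriv ?_
  rw [← tsum_div_const]
  refine tsum_congr fun n => ?_
  have := hx.1.ne'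
  rcases n with _ | n
  · simp
  · rw [Nat.add_sub_cancel, pow_succ]
    field_simp

open Set in
theorem contDiffOn_tsum_mul_pow (k : ℕ) {a : ℕ → ℝ}
    (ha : ∀ x ∈ Ioo (0 : ℝ) 1, Summable fun n => a n * x ^ n) :
    ContDiffOn ℝ k (fun y => ∑' n, a n * y ^ n) (Ioo 0 1) := by
  induction k generalizing a with
  | zero =>
    exact contDiffOn_zero.2 fun x hx =>
      (hasDerivAt_tsum_mul_pow ha hx).continuousAt.continuousWithinAt
  | succ k ih =>
    push_cast
    rw [contDiffOn_succ_iff_deriv_of_isOpen isOpen_Ioo]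
    refine ⟨fun x hx => (hasDerivAt_tsum_mul_pow ha hx).differentiableAt.differentiableWithinAt,
      fun h => absurd h (by simp), ?_⟩
    refine ((ih (summable_natCast_mul_mul_pow ha)).div contDiffOn_id fun x hx => hx.1.ne').congr
      fun x hx => ?_
    exact (hasDerivAt_tsum_mul_pow ha hx).deriv

/-- Coefficients of the hypergeometric series `₂F₁(q + √(11/2), q - √(11/2); c; x)`. -/
noncomputable def hypergeometricCoeff (q c : ℝ) : ℕ → ℝ
  | 0 => 1
  | n + 1 => ((n + q) ^ 2 - 11 / 2) / ((n + 1) * (n + c)) * hypergeometricCoeff q c n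

theorem hypergeometricCoeff_pos {q c : ℝ} (hq : 5 / 2 ≤ q) (hc : 0 < c) (n : ℕ) :
    0 < hypergeometricCoeff q c n := by
  induction n with
  | zero => simp [hypergeometricCoeff]
  | succ n ih =>
    have hn : (0 : ℝ) ≤ n := Nat.cast_nonneg n
    have h : 0 < ((n : ℝ) + q) ^ 2 - 11 / 2 := by nlinarith
    rw [hypergeometricCoeff]
    positivity

open Set Filter Topology in
theorem summable_hypergeometricCoeff_mul_pow {q c : ℝ} (hq : 5 / 2 ≤ q) (hc : 0 < c) :
    ∀ x ∈ Ioo (0 : ℝ) 1, Summable fun n => hypergeometricCoeff q c n * x ^ n := by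
  intro x hx
  have hpos (n : ℕ) : 0 < hypergeometricCoeff q c n * x ^ n :=
    mul_pos (hypergeometricCoeff_pos hq hc n) (pow_pos hx.1 n)
  refine summable_of_ratio_test_tendsto_lt_one hx.2 (.of_forall fun n => (hpos n).ne') ?_
  have hinv (d : ℝ) : Tendsto (fun n : ℕ => ((n : ℝ) + d)⁻¹) atTop (𝓝 0) :=
    (tendsto_natCast_atTop_atTop.atTop_add tendsto_const_nhds).inv_tendsto_atTop
  have hquot (d : ℝ) :
      Tendsto (fun n : ℕ => (n : ℝ) / (n + d) + q * ((n : ℝ) + d)⁻¹) atTop (𝓝 1) := by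
    simpa using (tendsto_natCast_div_add_atTop d).add ((hinv d).const_mul q)
  have hlim := (((hquot 1).mul (hquot c)).sub
    (((hinv 1).mul (hinv c)).const_mul (11 / 2))).mul_const x
  simp only [mul_one, mul_zero, sub_zero, one_mul] at hlim
  refine hlim.congr fun n => ?_
  rw [Real.norm_of_nonneg (hpos _).le, Real.norm_of_nonneg (hpos _).le, hypergeometricCoeff]
  have h := (hypergeometricCoeff_pos hq hc n).ne'
  have hn : (0 : ℝ) ≤ n := Nat.cast_nonneg n
  have h1 : (n : ℝ) + 1 ≠ 0 := by positivity
  have h2 : (n : ℝ) + c ≠ 0 := by positivity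
  have := hx.1.ne'
  field_simp
  ring

open Set in
/-- The hypergeometric equation, written with the Euler operator. -/
theorem tsum_hypergeometricCoeff_equation {q c : ℝ} (hq : 5 / 2 ≤ q) (hc : 0 < c) {x : ℝ}
    (hx : x ∈ Ioo (0 : ℝ) 1) :
    (∑' n : ℕ, n * (n * hypergeometricCoeff q c n) * x ^ n)
        + (c - 1) * ∑' n : ℕ, n * hypergeometricCoeff q c n * x ^ n
      = x * ((∑' n : ℕ, n * (n * hypergeometricCoeff q c n) * x ^ n)
        + 2 * q * (∑' n : ℕ, n * hypergeometricCoeff q c n * x ^ n)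
        + (q ^ 2 - 11 / 2) * ∑' n : ℕ, hypergeometricCoeff q c n * x ^ n) := by
  have s0 := summable_hypergeometricCoeff_mul_pow hq hc
  have s1 := summable_natCast_mul_mul_pow s0
  have s2 := summable_natCast_mul_mul_pow s1 x hx
  replace s0 := s0 x hx
  replace s1 := s1 x hx
  have hl := s2.hasSum.add (s1.hasSum.mul_left (c - 1))
  have hr := ((s2.hasSum.add (s1.hasSum.mul_left (2 * q))).add
    (s0.hasSum.mul_left (q ^ 2 - 11 / 2))).mul_left x
  rw [← hl.tsum_eq, ← hr.tsum_eq, hl.summable.tsum_eq_zero_add]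
  simp only [Nat.cast_zero, zero_mul, mul_zero, add_zero, zero_add]
  congr 1
  ext n
  have hn : (0 : ℝ) ≤ n := Nat.cast_nonneg n
  have h1 : (n : ℝ) + 1 ≠ 0 := by positivity
  have h2 : (n : ℝ) + c ≠ 0 := by positivity
  rw [hypergeometricCoeff]
  push_cast
  field_simp
  ring

open Set in
/-- A positive solution in the compactified coordinate `w = 1 - 2M/r`, which maps `(2M, ∞)` onto
`(0, 1)`. -/
theorem exists_positive_solution_compactified :
    ∃ U D : ℝ → ℝ, ContDiffOn ℝ 2 U (Ioo 0 1) ∧ (∀ w ∈ Ioo (0 : ℝ) 1, 0 < U w) ∧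
      (∀ w ∈ Ioo (0 : ℝ) 1, HasDerivAt U (D w) w) ∧
      ∀ w ∈ Ioo (0 : ℝ) 1, HasDerivAt (fun x => x ^ 2 * (1 - x) ^ 2 * D x)
        ((1 - 8 * w + 13 * w ^ 2) / 4 * U w) w := by
  obtain ⟨s, hs, hs'⟩ : ∃ s : ℝ, s ^ 2 + s = 1 / 4 ∧ 1 / 5 ≤ s := by
    have h : (7 / 5 : ℝ) ≤ √2 := Real.le_sqrt_of_sq_le (by norm_num)
    refine ⟨(√2 - 1) / 2, ?_, by linarith⟩
    linear_combination (Real.sq_sqrt (show (0 : ℝ) ≤ 2 by norm_num)) / 4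
  obtain ⟨p, hp, hp'⟩ : ∃ p : ℝ, p ^ 2 + p = 3 / 2 ∧ 4 / 5 ≤ p := by
    have h : (13 / 5 : ℝ) ≤ √7 := Real.le_sqrt_of_sq_le (by norm_num)
    refine ⟨(√7 - 1) / 2, ?_, by linarith⟩
    linear_combination (Real.sq_sqrt (show (0 : ℝ) ≤ 7 by norm_num)) / 4
  have hq : 5 / 2 ≤ s + p + 3 / 2 := by linarith
  have hc : 0 < 2 * s + 2 := by linarith
  have hF := summable_hypergeometricCoeff_mul_pow hq hc
  have hode := fun w hw => tsum_hypergeometricCoeff_equation (x := w) hq hc hw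
  have hF' := fun w hw => hasDerivAt_tsum_mul_pow (x := w) hF hw
  have hF1' := fun w hw =>
    hasDerivAt_tsum_mul_pow (x := w) (summable_natCast_mul_mul_pow hF) hw
  have hFC := contDiffOn_tsum_mul_pow 2 hF
  have hFpos : ∀ w ∈ Ioo (0 : ℝ) 1,
      0 < ∑' n, hypergeometricCoeff (s + p + 3 / 2) (2 * s + 2) n * w ^ n := fun w hw =>
    (hF w hw).tsum_pos (fun n => (mul_pos (hypergeometricCoeff_pos hq hc n) (pow_pos hw.1 n)).le) 0
      (mul_pos (hypergeometricCoeff_pos hq hc 0) (pow_pos hw.1 0))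
  set F : ℝ → ℝ := fun w => ∑' n, hypergeometricCoeff (s + p + 3 / 2) (2 * s + 2) n * w ^ n
  set F1 : ℝ → ℝ := fun w =>
    ∑' n : ℕ, n * hypergeometricCoeff (s + p + 3 / 2) (2 * s + 2) n * w ^ n
  set F2 : ℝ → ℝ := fun w =>
    ∑' n : ℕ, n * (n * hypergeometricCoeff (s + p + 3 / 2) (2 * s + 2) n) * w ^ n
  replace hode : ∀ w ∈ Ioo (0 : ℝ) 1, F2 w + (2 * s + 2 - 1) * F1 w =
    w * (F2 w + 2 * (s + p + 3 / 2) * F1 w + ((s + p + 3 / 2) ^ 2 - 11 / 2) * F w) := hode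
  replace hF' : ∀ w ∈ Ioo (0 : ℝ) 1, HasDerivAt F (F1 w / w) w := hF'
  replace hF1' : ∀ w ∈ Ioo (0 : ℝ) 1, HasDerivAt F1 (F2 w / w) w := hF1'
  have hg : ∀ w ∈ Ioo (0 : ℝ) 1, HasDerivAt (fun x : ℝ => x ^ s * (1 - x) ^ p)
      (w ^ s * (1 - w) ^ p * (s / w - p / (1 - w))) w := by
    intro w hw
    have h0 : w ≠ 0 := hw.1.ne'
    have h1 : 1 - w ≠ 0 := (sub_pos.2 hw.2).ne'
    refine HasDerivAt.congr_deriv (((hasDerivAt_id w).rpow_const (p := s) (Or.inl h0)).mul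
      (((hasDerivAt_id w).const_sub 1).rpow_const (p := p) (Or.inl h1))) ?_
    simp only [id]
    rw [Real.rpow_sub_one h0, Real.rpow_sub_one h1]
    field_simp
    ring
  have hgC : ContDiffOn ℝ 2 (fun x : ℝ => x ^ s * (1 - x) ^ p) (Ioo 0 1) :=
    (contDiffOn_id.rpow_const_of_ne fun w hw => hw.1.ne').mul
      ((contDiffOn_const.sub contDiffOn_id).rpow_const_of_ne fun w hw => (sub_pos.2 hw.2).ne')
  set g : ℝ → ℝ := fun x => x ^ s * (1 - x) ^ p
  replace hg : ∀ w ∈ Ioo (0 : ℝ) 1, HasDerivAt g (g w * (s / w - p / (1 - w))) w := hg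
  refine ⟨fun w => g w * F w, fun w => g w * (s / w - p / (1 - w)) * F w + g w * (F1 w / w),
    hgC.mul hFC, fun w hw => ?_, fun w hw => (hg w hw).mul (hF' w hw), fun w hw => ?_⟩
  · have := sub_pos.2 hw.2
    have := hw.1
    exact mul_pos (by positivity) (hFpos w hw)
  · have h0 : w ≠ 0 := hw.1.ne'
    have h1 : 1 - w ≠ 0 := (sub_pos.2 hw.2).ne'
    have hid := hasDerivAt_id w
    have hid1 := hid.const_sub 1
    have hflux := ((hg w hw).mul (hid.mul hid1)).mul
      ((((hid.const_mul (s + p)).const_sub s).mul (hF' w hw)).add (hid1.mul (hF1' w hw)))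
    have heq : (fun x => x ^ 2 * (1 - x) ^ 2 *
        (g x * (s / x - p / (1 - x)) * F x + g x * (F1 x / x))) =ᶠ[nhds w]
        fun x => g x * (x * (1 - x)) * ((s - (s + p) * x) * F x + (1 - x) * F1 x) := by
      filter_upwards [isOpen_Ioo.mem_nhds hw] with x hx
      have h0 : x ≠ 0 := hx.1.ne'
      have h1 : 1 - x ≠ 0 := (sub_pos.2 hx.2).ne'
      field_simp
      ring
    refine HasDerivAt.congr_of_eventuallyEq ?_ heq
    refine hflux.congr_deriv ?_
    change (g w * (s / w - p / (1 - w)) * (w * (1 - w)) + g w * (1 * (1 - w) + w * -1))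
        * ((s - (s + p) * w) * F w + (1 - w) * F1 w) + g w * (w * (1 - w))
        * ((-((s + p) * 1) * F w + (s - (s + p) * w) * (F1 w / w))
          + (-1 * F1 w + (1 - w) * (F2 w / w)))
      = (1 - 8 * w + 13 * w ^ 2) / 4 * (g w * F w)
    field_simp
    linear_combination 4 * g w * ((1 - w) * hode w hw + F w * ((1 - w) * hs + w * hp))

/-- Existence of a positive `C²` solution to the ODE
`∂_r(B^r ∂_r u) = V̄¹ u` on `(2M, ∞)`. -/
theorem exists_positive_solution_V1 (M : ℝ) (hM : 0 < M) :
    ∃ u : ℝ → ℝ, ContDiffOn ℝ 2 u (Set.Ioi (2 * M)) ∧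
      (∀ r ∈ Set.Ioi (2 * M), 0 < u r) ∧
      (∀ r ∈ Set.Ioi (2 * M),
        HasDerivAt (fun x => M * (x - 2 * M) ^ 2 / x ^ 2 * deriv u x)
          (((3 / 2) * M / r ^ 2 - 9 * M ^ 2 / r ^ 3 + 13 * M ^ 3 / r ^ 4) * u r)
          r) := by
  obtain ⟨U, D, hC, hpos, hU, hD⟩ := exists_positive_solution_compactified
  have hr0 : ∀ r ∈ Set.Ioi (2 * M), 0 < r := fun r hr =>
    (show 0 < 2 * M by positivity).trans hr
  have hmaps : ∀ r ∈ Set.Ioi (2 * M), 1 - 2 * M / r ∈ Set.Ioo (0 : ℝ) 1 := fun r hr => by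
    have h0 := hr0 r hr
    have h1 : 2 * M / r < 1 := (div_lt_one h0).2 hr
    have h2 : 0 < 2 * M / r := by positivity
    exact ⟨by linarith, by linarith⟩
  have hw : ∀ r ∈ Set.Ioi (2 * M),
      HasDerivAt (fun x => 1 - 2 * M / x) (2 * M / r ^ 2) r := fun r hr => by
    have h0 := (hr0 r hr).ne'
    refine (((hasDerivAt_inv h0).const_mul (2 * M)).const_sub 1).congr_deriv ?_
    field_simp
  refine ⟨fun r => U (1 - 2 * M / r), ?_, fun r hr => hpos _ (hmaps r hr), fun r hr => ?_⟩
  · exact hC.comp (contDiffOn_const.sub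
      (contDiffOn_const.div contDiffOn_id fun r hr => (hr0 r hr).ne')) hmaps
  · have h0 := (hr0 r hr).ne'
    have heq : (fun x => M * (x - 2 * M) ^ 2 / x ^ 2 * deriv (fun r => U (1 - 2 * M / r)) x)
        =ᶠ[nhds r] fun x => ((1 - 2 * M / x) ^ 2 * (1 - (1 - 2 * M / x)) ^ 2
          * D (1 - 2 * M / x)) / 2 := by
      filter_upwards [isOpen_Ioi.mem_nhds hr] with x hx
      have h0 := (hr0 x hx).ne'
      have hd : deriv (fun r => U (1 - 2 * M / r)) x = D (1 - 2 * M / x) * (2 * M / x ^ 2) :=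
        ((hU _ (hmaps x hx)).comp x (hw x hx)).deriv
      rw [hd]
      generalize D (1 - 2 * M / x) = d
      field_simp
      ring
    refine HasDerivAt.congr_of_eventuallyEq ?_ heq
    refine (((hD _ (hmaps r hr)).comp r (hw r hr)).div_const 2).congr_deriv ?_
    beta_reduce
    generalize U (1 - 2 * M / r) = v
    field_simp
    ring
end

section
/- Let x₀ ∈ ℝ, let B, V : ℝ → ℝ be continuous on (x₀, ∞) with B(r) > 0 for all r > x₀, and suppose u : ℝ → ℝ is twice continuously differentiable on (x₀, ∞), positive there, and satisfies d/dr(B(r)u′(r)) = V(r)u(r) on (x₀, ∞). Then for every smooth φ : ℝ → ℂ compactly supported in (x₀, ∞), ∫_{x₀}^{∞} ( B(r)|φ′(r)|² + V(r)|φ(r)|² ) dr ≥ 0. -/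
open MeasureTheory

/-- A compact subset of an open half-line lies strictly between two points of the half-line. -/
lemma IsCompact.exists_subset_Ioo_of_subset_Ioi {K : Set ℝ} {x₀ : ℝ} (hK : IsCompact K)
    (hKs : K ⊆ Set.Ioi x₀) : ∃ a b, x₀ < a ∧ a ≤ b ∧ K ⊆ Set.Ioo a b := by
  have hK' : IsCompact (insert (x₀ + 1) K) := hK.insert _
  have hne : (insert (x₀ + 1) K).Nonempty := Set.insert_nonempty _ _
  obtain ⟨m, hm, hmin⟩ := hK'.exists_isLeast hne
  obtain ⟨M, -, hmax⟩ := hK'.exists_isGreatest hne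
  have hm0 : x₀ < m := by
    rcases hm with rfl | hm
    · linarith
    · exact hKs hm
  have hmM : m ≤ M := hmax hm
  refine ⟨(x₀ + m) / 2, M + 1, by linarith, by linarith, fun x hx => ⟨?_, ?_⟩⟩
  · linarith [hmin (Set.mem_insert_of_mem _ hx)]
  · linarith [hmax (Set.mem_insert_of_mem _ hx)]

/-- The derivative of `p * ‖φ‖ ^ 2 / u` at a point where `p` has derivative `q * u`. -/
lemma hasDerivAt_mul_norm_sq_div {p u : ℝ → ℝ} {φ : ℝ → ℂ} {q u' r : ℝ} {φ' : ℂ}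
    (hp : HasDerivAt p (q * u r) r) (hu : HasDerivAt u u' r) (hφ : HasDerivAt φ φ' r)
    (hur : u r ≠ 0) :
    HasDerivAt (fun x => p x * ‖φ x‖ ^ 2 / u x)
      (q * ‖φ r‖ ^ 2 + p r * (2 * (inner ℝ (φ r) φ' / u r) - ‖φ r‖ ^ 2 * u' / u r ^ 2)) r := by
  refine ((hp.mul hφ.norm_sq).div hu hur).congr_deriv ?_
  simp only [Pi.mul_apply]
  field_simp
  ring

/-- The pointwise form of Picone's inequality. -/
lemma picone_le {b v w w' : ℝ} (hb : 0 ≤ b) (hw : w ≠ 0) (z z' : ℂ) :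
    v * ‖z‖ ^ 2 + b * w' * (2 * (inner ℝ z z' / w) - ‖z‖ ^ 2 * w' / w ^ 2) ≤
      b * ‖z'‖ ^ 2 + v * ‖z‖ ^ 2 := by
  have h : ‖z' - (w' / w) • z‖ ^ 2 =
      ‖z'‖ ^ 2 - 2 * (w' / w * inner ℝ z z') + (w' / w) ^ 2 * ‖z‖ ^ 2 := by
    rw [norm_sub_sq_real, real_inner_smul_right, norm_smul, mul_pow, Real.norm_eq_abs, sq_abs,
      real_inner_comm]
  have h0 : 0 ≤ b * ‖z' - (w' / w) • z‖ ^ 2 := by positivity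
  rw [h] at h0
  have h1 : b * w' * (2 * (inner ℝ z z' / w) - ‖z‖ ^ 2 * w' / w ^ 2) =
      b * (2 * (w' / w * inner ℝ z z') - (w' / w) ^ 2 * ‖z‖ ^ 2) := by
    field_simp
  rw [h1]
  linarith

/-- Positive-supersolution criterion for nonnegativity of one-dimensional
Schrödinger-type quadratic forms. -/
theorem quadratic_form_nonneg_of_positive_supersolution (x₀ : ℝ) (B V : ℝ → ℝ)
    (hB : ContinuousOn B (Set.Ioi x₀)) (hV : ContinuousOn V (Set.Ioi x₀))
    (hBpos : ∀ r ∈ Set.Ioi x₀, 0 < B r)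
    (u : ℝ → ℝ) (hu : ContDiffOn ℝ 2 u (Set.Ioi x₀))
    (hupos : ∀ r ∈ Set.Ioi x₀, 0 < u r)
    (hODE : ∀ r ∈ Set.Ioi x₀,
      HasDerivAt (fun x => B x * deriv u x) (V r * u r) r)
    (φ : ℝ → ℂ) (hφ : ContDiff ℝ (⊤ : ℕ∞) φ) (hφc : HasCompactSupport φ)
    (hφs : tsupport φ ⊆ Set.Ioi x₀) :
    0 ≤ ∫ r in Set.Ioi x₀, (B r * ‖deriv φ r‖ ^ 2 + V r * ‖φ r‖ ^ 2) := by
  obtain ⟨a, b, ha, hab, hK⟩ := hφc.isCompact.exists_subset_Ioo_of_subset_Ioi hφs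
  have hsub : Set.Icc a b ⊆ Set.Ioi x₀ := fun x hx => ha.trans_le hx.1
  have hφ0 : ∀ x ∉ Set.Ioo a b, φ x = 0 := fun x hx =>
    image_eq_zero_of_notMem_tsupport fun h => hx (hK h)
  have hdφ0 : ∀ x ∉ Set.Ioo a b, deriv φ x = 0 := fun x hx =>
    Function.notMem_support.1 fun h => hx (hK (support_deriv_subset h))
  have hrestrict : ∫ r in Set.Ioi x₀, (B r * ‖deriv φ r‖ ^ 2 + V r * ‖φ r‖ ^ 2) =
      ∫ r in a..b, (B r * ‖deriv φ r‖ ^ 2 + V r * ‖φ r‖ ^ 2) := by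
    rw [intervalIntegral.integral_of_le hab]
    refine setIntegral_eq_of_subset_of_forall_sdiff_eq_zero measurableSet_Ioi
      (Set.Ioc_subset_Icc_self.trans hsub) fun x hx => ?_
    have hx' : x ∉ Set.Ioo a b := fun h => hx.2 (Set.Ioo_subset_Ioc_self h)
    simp [hφ0 x hx', hdφ0 x hx']
  have hderiv : ∀ r ∈ Set.Icc a b, HasDerivAt (fun x => B x * deriv u x * ‖φ x‖ ^ 2 / u x)
      (V r * ‖φ r‖ ^ 2 + B r * deriv u r *
        (2 * (inner ℝ (φ r) (deriv φ r) / u r) - ‖φ r‖ ^ 2 * deriv u r / u r ^ 2)) r := by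
    intro r hr
    exact hasDerivAt_mul_norm_sq_div (hODE r (hsub hr))
      ((hu.differentiableOn (by norm_num)).differentiableAt
        (Ioi_mem_nhds (hsub hr))).hasDerivAt
      (hφ.differentiable (by simp) r).hasDerivAt (hupos r (hsub hr)).ne'
  have hint : IntegrableOn (fun r => B r * ‖deriv φ r‖ ^ 2 + V r * ‖φ r‖ ^ 2)
      (Set.Icc a b) := by
    have hdφ : Continuous (deriv φ) := hφ.continuous_deriv (by simp)
    exact (((hB.mono hsub).mul (hdφ.norm.pow 2).continuousOn).add
      ((hV.mono hsub).mul (hφ.continuous.norm.pow 2).continuousOn)).integrableOn_Icc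
  have hle := intervalIntegral.sub_le_integral_of_hasDeriv_right_of_le hab
    (fun r hr => (hderiv r hr).continuousAt.continuousWithinAt)
    (fun r hr => (hderiv r (Set.Ioo_subset_Icc_self hr)).hasDerivWithinAt) hint
    (fun r hr => picone_le (hBpos r (hsub (Set.Ioo_subset_Icc_self hr))).le
      (hupos r (hsub (Set.Ioo_subset_Icc_self hr))).ne' _ _)
  rw [hrestrict]
  simpa [hφ0 a (by simp), hφ0 b (by simp)] using hle
end

section
/- Let s and m be integers. Then for every smooth function ψ : ℝ → ℂ compactly supported in the open interval (0, π), ∫_0^π [ |ψ′(θ)|² + ( (m + s·cosθ)²/sin²θ + s² ) |ψ(θ)|² ] sinθ dθ ≥ max{ |s|(|s|+1), |m|(|m|+1) } · ∫_0^π |ψ(θ)|² sinθ dθ. -/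
open MeasureTheory

/-- If `(a + b cos θ) / sin θ` is the logarithmic derivative of a ground state with eigenvalue `K`,
then `K` bounds the spin-weighted quadratic form from below. -/
theorem spin_weighted_lower_bound_of_ground_state {s m a b K : ℝ}
    (h : ∀ c : ℝ, (m + s * c) ^ 2 - (a + b * c) ^ 2 = (K - b - s ^ 2) * (1 - c ^ 2))
    {ψ : ℝ → ℂ} (hψ : ContDiff ℝ (⊤ : ℕ∞) ψ) (hc : HasCompactSupport ψ)
    (hs : tsupport ψ ⊆ Set.Ioo 0 Real.pi) :
    K * ∫ θ in Set.Ioo 0 Real.pi, ‖ψ θ‖ ^ 2 * Real.sin θ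
      ≤ ∫ θ in Set.Ioo 0 Real.pi,
          (‖deriv ψ θ‖ ^ 2
            + ((m + s * Real.cos θ) ^ 2 / Real.sin θ ^ 2 + s ^ 2) * ‖ψ θ‖ ^ 2) * Real.sin θ := by
  have hcont : Continuous ψ := hψ.continuous
  have hcont' : Continuous (deriv ψ) := hψ.continuous_deriv (by simp)
  have hsin : ∀ θ ∈ Set.Ioo 0 Real.pi, 0 < Real.sin θ := fun θ hθ =>
    Real.sin_pos_of_pos_of_lt_pi hθ.1 hθ.2
  have hvanish : ∀ θ, θ ∉ tsupport ψ → ψ θ = 0 ∧ deriv ψ θ = 0 := fun θ hθ =>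
    ⟨image_eq_zero_of_notMem_tsupport hθ,
      Function.notMem_support.1 fun h' => hθ (support_deriv_subset h')⟩
  have hform : IntegrableOn (fun θ => (‖deriv ψ θ‖ ^ 2
      + ((m + s * Real.cos θ) ^ 2 / Real.sin θ ^ 2 + s ^ 2) * ‖ψ θ‖ ^ 2) * Real.sin θ)
      (Set.Ioo 0 Real.pi) := by
    refine Integrable.integrableOn
      ((integrableOn_iff_integrable_of_support_subset (s := tsupport ψ) ?_).1 ?_)
    · intro θ hθ
      by_contra hn
      obtain ⟨h0, h1⟩ := hvanish θ hn
      simp [h0, h1] at hθ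
    · refine ContinuousOn.integrableOn_compact hc ?_
      have hd : ContinuousOn (fun θ => (m + s * Real.cos θ) ^ 2 / Real.sin θ ^ 2) (tsupport ψ) :=
        ContinuousOn.div (by fun_prop) (by fun_prop)
          fun θ hθ => pow_ne_zero 2 (hsin θ (hs hθ)).ne'
      fun_prop
  have hmass : IntegrableOn (fun θ => ‖ψ θ‖ ^ 2 * Real.sin θ) (Set.Ioo 0 Real.pi) :=
    (Continuous.integrableOn_Icc (by fun_prop)).mono_set Set.Ioo_subset_Icc_self
  set F' : ℝ → ℝ := fun θ => (b * -Real.sin θ) * ‖ψ θ‖ ^ 2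
    + (a + b * Real.cos θ) * (2 * inner ℝ (ψ θ) (deriv ψ θ)) with hF'
  have hF'cont : Continuous F' := by fun_prop
  have hF'int : IntegrableOn F' (Set.Ioo 0 Real.pi) :=
    hF'cont.integrableOn_Icc.mono_set Set.Ioo_subset_Icc_self
  have hF'zero : ∫ θ in Set.Ioo 0 Real.pi, F' θ = 0 := by
    have hderiv : ∀ θ ∈ Set.uIcc 0 Real.pi,
        HasDerivAt (fun θ => (a + b * Real.cos θ) * ‖ψ θ‖ ^ 2) (F' θ) θ := fun θ _ =>
      (((Real.hasDerivAt_cos θ).const_mul b).const_add a).mul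
        ((hψ.differentiable (by simp)) θ).hasDerivAt.norm_sq
    have h0 : ψ 0 = 0 := (hvanish 0 fun h' => (hs h').1.false).1
    have hpi : ψ Real.pi = 0 := (hvanish _ fun h' => (hs h').2.false).1
    rw [← integral_Ioc_eq_integral_Ioo, ← intervalIntegral.integral_of_le Real.pi_pos.le,
      intervalIntegral.integral_eq_sub_of_hasDerivAt hderiv (hF'cont.intervalIntegrable _ _)]
    simp [h0, hpi]
  have hsum := integral_add (hmass.const_mul K) hF'int
  rw [hF'zero, add_zero] at hsum
  rw [← integral_const_mul, ← hsum]
  refine setIntegral_mono_on ((hmass.const_mul K).add hF'int) hform measurableSet_Ioo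
    fun θ hθ => ?_
  have hpos := hsin θ hθ
  have hsq := norm_sub_sq_real (deriv ψ θ) (((a + b * Real.cos θ) / Real.sin θ) • ψ θ)
  rw [inner_smul_right, norm_smul, mul_pow, Real.norm_eq_abs, sq_abs, real_inner_comm] at hsq
  have hpot : (m + s * Real.cos θ) ^ 2 / Real.sin θ ^ 2
      = ((a + b * Real.cos θ) / Real.sin θ) ^ 2 + (K - b - s ^ 2) := by
    rw [div_pow, div_eq_iff (by positivity), add_mul, div_mul_cancel₀ _ (by positivity),
      Real.sin_sq]
    linarith [h (Real.cos θ)]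
  have hnum : a + b * Real.cos θ = (a + b * Real.cos θ) / Real.sin θ * Real.sin θ :=
    (div_mul_cancel₀ _ hpos.ne').symm
  have hnn := mul_nonneg (sq_nonneg
    ‖deriv ψ θ - ((a + b * Real.cos θ) / Real.sin θ) • ψ θ‖) hpos.le
  rw [hsq] at hnn
  simp only [hF']
  rw [hpot]
  generalize (a + b * Real.cos θ) / Real.sin θ = g at *
  rw [hnum]
  linarith

/-- The quadratic form of the spin-weighted spherical harmonic operator `−𝐒_m`
is bounded below by its least eigenvalue `max{|s|(|s|+1), |m|(|m|+1)}`. -/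
theorem spin_weighted_angular_lower_bound (s m : ℤ) :
    ∀ ψ : ℝ → ℂ, ContDiff ℝ (⊤ : ℕ∞) ψ → HasCompactSupport ψ →
      tsupport ψ ⊆ Set.Ioo 0 Real.pi →
      ((max (|s| * (|s| + 1)) (|m| * (|m| + 1)) : ℤ) : ℝ) *
          ∫ θ in Set.Ioo 0 Real.pi, ‖ψ θ‖ ^ 2 * Real.sin θ
      ≤ ∫ θ in Set.Ioo 0 Real.pi,
          (‖deriv ψ θ‖ ^ 2
            + (((m : ℝ) + (s : ℝ) * Real.cos θ) ^ 2 / Real.sin θ ^ 2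
                + (s : ℝ) ^ 2) * ‖ψ θ‖ ^ 2) * Real.sin θ := by
  intro ψ hψ hc hs
  rcases max_choice (|s| * (|s| + 1)) (|m| * (|m| + 1)) with h | h <;> rw [h] <;> push_cast
  · rcases abs_choice (s : ℝ) with h' | h' <;> rw [h']
    · exact spin_weighted_lower_bound_of_ground_state (a := m) (b := s)
        (fun c => by ring) hψ hc hs
    · exact spin_weighted_lower_bound_of_ground_state (a := -m) (b := -s)
        (fun c => by ring) hψ hc hs
  · rcases abs_choice (m : ℝ) with h' | h' <;> rw [h']
    · exact spin_weighted_lower_bound_of_ground_state (a := s) (b := m)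
        (fun c => by ring) hψ hc hs
    · exact spin_weighted_lower_bound_of_ground_state (a := -s) (b := -m)
        (fun c => by ring) hψ hc hs
end
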